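/- Let n ≥ 2 and let Y₁ be an n×n integer matrix such that Y₁² = Y₁ and Σ_{i=0}^{n−1} X^{n−i} Y₁ X^{i} = I_n. Then: (1) the trace of Y₁ equals 1; (2) Y₁ X^j Y₁ = 0 for all 1 ≤ j ≤ n−1; and (3) the pair (X, Y₁) generates M_n(ℤ), i.e., the non-unital subring of M_n(ℤ) generated by X and Y₁ is all of M_n(ℤ). -/

import Mathlib

/-- The `n × n` cyclic permutation matrix `X = E₂₁ + E₃₂ + ⋯ + E_{n,n-1} + E_{1n}`,
with `X i j = 1` iff `i ≡ j + 1 (mod n)`. -/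
def Xmat (n : ℕ) : Matrix (Fin n) (Fin n) ℤ :=
  Matrix.of fun i j => if (i : ℕ) = ((j : ℕ) + 1) % n then 1 else 0

theorem Xmat_pow_apply (n k : ℕ) (i j : Fin n) :
    (Xmat n ^ k) i j = if (i : ℕ) = ((j : ℕ) + k) % n then 1 else 0 := by
  induction k generalizing j with
  | zero => simp [Matrix.one_apply, Nat.mod_eq_of_lt j.isLt, Fin.ext_iff]
  | succ k ih =>
    have hn : 0 < n := j.pos
    rw [pow_succ, Matrix.mul_apply,
      Finset.sum_eq_single (⟨((j : ℕ) + 1) % n, Nat.mod_lt _ hn⟩ : Fin n)]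
    · rw [ih]
      simp [Xmat, add_assoc, add_comm 1 k]
    · intro l _ hl
      rw [Xmat, Matrix.of_apply, if_neg fun h => hl (Fin.ext h), mul_zero]
    · simp

theorem Xmat_pow_card (n : ℕ) : Xmat n ^ n = 1 := by
  ext i j
  simp [Xmat_pow_apply, Matrix.one_apply, Nat.mod_eq_of_lt j.isLt, Fin.ext_iff]

/-- If the sum of the conjugates of a matrix by the powers of `Xmat n` is the identity, the
matrix has trace one. -/
theorem trace_eq_one_of_sum_conj {n : ℕ} (hn : n ≠ 0) {Y : Matrix (Fin n) (Fin n) ℤ}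
    (h : ∑ i ∈ Finset.range n, Xmat n ^ (n - i) * Y * Xmat n ^ i = 1) : Y.trace = 1 := by
  have ht := congrArg Matrix.trace h
  rw [Matrix.trace_sum, Finset.sum_congr rfl (g := fun _ => Y.trace)] at ht
  · simpa [hn] using ht
  · intro i hi
    rw [Matrix.trace_mul_comm, ← mul_assoc, ← pow_add,
      Nat.add_sub_of_le (Finset.mem_range.1 hi).le, Xmat_pow_card, one_mul]

/-- An idempotent integer matrix of trace one is an outer product. -/
theorem exists_eq_vecMulVec_of_trace_eq_one {m : Type*} [Fintype m] [DecidableEq m]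
    {Y : Matrix m m ℤ} (hY : IsIdempotentElem Y) (ht : Y.trace = 1) :
    ∃ u w : m → ℤ, Y = Matrix.vecMulVec u w := by
  have he : IsIdempotentElem (Matrix.toLin' Y) := by
    rw [IsIdempotentElem, Module.End.mul_eq_comp, ← Matrix.toLin'_mul, hY.eq]
  have hr := (LinearMap.isProj_range_iff_isIdempotentElem _).2 he |>.trace
  rw [Matrix.trace_toLin'_eq, ht] at hr
  obtain ⟨e⟩ := Module.nonempty_linearEquiv_of_finrank_eq_one
    (R := ℤ) (M := LinearMap.range (Matrix.toLin' Y)) (by exact_mod_cast hr.symm)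
  refine ⟨(e 1 : m → ℤ),
    fun j => e.symm ⟨Matrix.toLin' Y (Pi.single j 1), LinearMap.mem_range_self _ _⟩, ?_⟩
  ext i j
  set x : LinearMap.range (Matrix.toLin' Y) :=
    ⟨Matrix.toLin' Y (Pi.single j 1), LinearMap.mem_range_self _ _⟩
  have hx : e.symm x • e 1 = x := by
    rw [← map_smul, smul_eq_mul, mul_one, LinearEquiv.apply_symm_apply]
  have := congrFun (congrArg Subtype.val hx) i
  simp only [Submodule.coe_smul, Pi.smul_apply, smul_eq_mul] at this
  rw [Matrix.vecMulVec_apply, mul_comm, this]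
  simp [x]

open Matrix in
theorem vecMulVec_mul_mul_vecMulVec {m R : Type*} [Fintype m] [CommRing R]
    (u w : m → R) (B : Matrix m m R) :
    vecMulVec u w * B * vecMulVec u w = (w ⬝ᵥ B *ᵥ u) • vecMulVec u w := by
  rw [mul_assoc, mul_vecMulVec, vecMulVec_mul_vecMulVec, vecMulVec_smul]

open Matrix in
/-- If the rank-one matrices `(P i *ᵥ u) ⊗ (w ᵥ* Q i)` sum to the identity, the vectors and
covectors involved are dual to each other. -/
theorem dotProduct_eq_of_sum_vecMulVec {m R : Type*} [Fintype m] [DecidableEq m] [CommRing R]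
    (u w : m → R) (P Q : m → Matrix m m R)
    (h : ∑ i, P i * vecMulVec u w * Q i = 1) (i k : m) :
    w ⬝ᵥ (Q i * P k) *ᵥ u = if i = k then 1 else 0 := by
  let U : Matrix m m R := of fun a i => (P i *ᵥ u) a
  let W : Matrix m m R := of fun i b => (w ᵥ* Q i) b
  have hUW : U * W = 1 := by
    rw [← h]
    ext a b
    simp [U, W, Matrix.mul_apply, Matrix.sum_apply, mul_vecMulVec, vecMulVec_mul, vecMulVec_apply]
  have hWU : (W * U) i k = (1 : Matrix m m R) i k := by rw [mul_eq_one_comm.1 hUW]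
  rw [← mulVec_mulVec, dotProduct_mulVec, ← Matrix.one_apply, ← hWU]
  rfl

theorem mul_Xmat_pow_mul_eq_zero {n : ℕ} {u w : Fin n → ℤ}
    (h : ∑ i ∈ Finset.range n, Xmat n ^ (n - i) * Matrix.vecMulVec u w * Xmat n ^ i = 1)
    {j : ℕ} (hj : 1 ≤ j) (hjn : j < n) :
    Matrix.vecMulVec u w * Xmat n ^ j * Matrix.vecMulVec u w = 0 := by
  rw [Finset.sum_range] at h
  have := dotProduct_eq_of_sum_vecMulVec u w (fun i => Xmat n ^ (n - i))
    (fun i => Xmat n ^ (i : ℕ)) h ⟨0, by omega⟩ ⟨n - j, by omega⟩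
  rw [if_neg (by simp only [Fin.ext_iff]; omega), pow_zero, one_mul,
    show n - (n - j) = j by omega] at this
  rw [vecMulVec_mul_mul_vecMulVec, this, zero_smul]

theorem closure_Xmat_vecMulVec_eq_top {n : ℕ} (hn : n ≠ 0) {u w : Fin n → ℤ}
    (h : ∑ i ∈ Finset.range n, Xmat n ^ (n - i) * Matrix.vecMulVec u w * Xmat n ^ i = 1) :
    NonUnitalSubring.closure ({Xmat n, Matrix.vecMulVec u w} : Set (Matrix (Fin n) (Fin n) ℤ)) =
      ⊤ := by
  set Y := Matrix.vecMulVec u w with hY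
  set S := NonUnitalSubring.closure ({Xmat n, Y} : Set (Matrix (Fin n) (Fin n) ℤ))
  have hX : Xmat n ∈ S := NonUnitalSubring.subset_closure (by simp)
  have hYS : Y ∈ S := NonUnitalSubring.subset_closure (by simp)
  have hpos (k : ℕ) : Xmat n ^ (k + 1) ∈ S := by
    induction k with
    | zero => simpa using hX
    | succ k ih => rw [pow_succ]; exact mul_mem ih hX
  have hpow : ∀ k : ℕ, Xmat n ^ k ∈ S
    | 0 => by
      obtain ⟨m, rfl⟩ := Nat.exists_eq_succ_of_ne_zero hn
      rw [pow_zero, ← Xmat_pow_card]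
      exact hpos m
    | k + 1 => hpos k
  refine eq_top_iff.2 fun A _ => ?_
  have hA : A = ∑ i ∈ Finset.range n, ∑ j ∈ Finset.range n,
      Xmat n ^ (n - i) * (Y * (Xmat n ^ i * A * Xmat n ^ (n - j)) * Y) * Xmat n ^ j := by
    conv_lhs => rw [← one_mul A, ← mul_one (1 * A), ← h]
    simp only [Finset.sum_mul, Finset.mul_sum, mul_assoc]
    exact Finset.sum_comm
  rw [hA]
  refine sum_mem fun i _ => sum_mem fun j _ => mul_mem (mul_mem (hpow _) ?_) (hpow _)
  rw [hY, vecMulVec_mul_mul_vecMulVec]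
  exact zsmul_mem hYS _

theorem stmt_19 (n : ℕ) (hn : 2 ≤ n) (Y₁ : Matrix (Fin n) (Fin n) ℤ)
    (h1 : Y₁ * Y₁ = Y₁)
    (h2 : ∑ i ∈ Finset.range n, (Xmat n) ^ (n - i) * Y₁ * (Xmat n) ^ i = 1) :
    Y₁.trace = 1 ∧
      (∀ j : ℕ, 1 ≤ j → j ≤ n - 1 → Y₁ * (Xmat n) ^ j * Y₁ = 0) ∧
      NonUnitalSubring.closure ({Xmat n, Y₁} : Set (Matrix (Fin n) (Fin n) ℤ)) = ⊤ := by
  have ht := trace_eq_one_of_sum_conj (by omega) h2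
  obtain ⟨u, w, rfl⟩ := exists_eq_vecMulVec_of_trace_eq_one h1 ht
  exact ⟨ht, fun j hj hjn => mul_Xmat_pow_mul_eq_zero h2 hj (by omega),
    closure_Xmat_vecMulVec_eq_top (by omega) h2⟩
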